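/- Let Z be an n×n invertible complex matrix and let D be the (real) Fréchet derivative at Z of the map ρ₂(Z) = (Z*Z # conj(Z*Z))^{1/2}. Then for every n×n complex matrix A: ‖D(A)‖ ≤ (1/2)·‖Z^{-1}‖·β(Z)·(1 + ‖C_Z‖²)·‖Z*A + A*Z‖. -/

import Mathlib

open Matrix MeasureTheory Real
open scoped Matrix.Norms.L2Operator ComplexOrder

-- the positive semidefinite square root, as formerly defined in Mathlib
noncomputable def Matrix.PosSemidef.sqrt {n : Type*} {𝕜 : Type*} [Fintype n] [RCLike 𝕜]
    [DecidableEq n] {A : Matrix n n 𝕜} (hA : A.PosSemidef) : Matrix n n 𝕜 :=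
  hA.1.eigenvectorUnitary.1 * diagonal ((fun x : ℝ => (x : 𝕜)) ∘ Real.sqrt ∘ hA.1.eigenvalues) *
    (star hA.1.eigenvectorUnitary : Matrix n n 𝕜)

-- `psqrt M` is the unique positive semidefinite square root of a positive semidefinite matrix
open Classical in
noncomputable def psqrt {n : ℕ} (M : Matrix (Fin n) (Fin n) ℂ) : Matrix (Fin n) (Fin n) ℂ :=
  if h : M.PosSemidef then h.sqrt else 0

-- the geometric mean  A#B = A^{1/2} (A^{-1/2} B A^{-1/2})^{1/2} A^{1/2}
noncomputable def gm {n : ℕ} (A B : Matrix (Fin n) (Fin n) ℂ) : Matrix (Fin n) (Fin n) ℂ :=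
  psqrt A * psqrt ((psqrt A)⁻¹ * B * (psqrt A)⁻¹) * psqrt A

-- entrywise complex conjugate
def mconj {n : ℕ} (M : Matrix (Fin n) (Fin n) ℂ) : Matrix (Fin n) (Fin n) ℂ := Mᴴᵀ

-- smallest eigenvalue of a Hermitian matrix
noncomputable def lmin {n : ℕ} {C : Matrix (Fin n) (Fin n) ℂ} (hC : C.IsHermitian) : ℝ :=
  ⨅ i, hC.eigenvalues i

-- ρ₂(Z) = (Z*Z # conj(Z*Z))^{1/2}
noncomputable def rho2 {n : ℕ} (Z : Matrix (Fin n) (Fin n) ℂ) : Matrix (Fin n) (Fin n) ℂ :=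
  psqrt (gm (Zᴴ * Z) (mconj (Zᴴ * Z)))

-- C_Z = (Z*Z)⁻¹ (Z*Z # conj(Z*Z))
noncomputable def CZ {n : ℕ} (Z : Matrix (Fin n) (Fin n) ℂ) : Matrix (Fin n) (Fin n) ℂ :=
  (Zᴴ * Z)⁻¹ * gm (Zᴴ * Z) (mconj (Zᴴ * Z))

-- β(Z) = ∫₀^∞ ‖exp(-t C_Z)‖² dt
noncomputable def beta {n : ℕ} (Z : Matrix (Fin n) (Fin n) ℂ) : ℝ :=
  ∫ t in Set.Ioi (0 : ℝ), ‖NormedSpace.exp ((-t) • CZ Z)‖ ^ 2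

-- cond(Z) = ‖Z‖ ‖Z⁻¹‖
noncomputable def condNum {n : ℕ} (Z : Matrix (Fin n) (Fin n) ℂ) : ℝ := ‖Z‖ * ‖Z⁻¹‖


lemma psqrt_posSemidef {n : ℕ} {M : Matrix (Fin n) (Fin n) ℂ} (h : M.PosSemidef) :
    (psqrt M).PosSemidef := by
  rw [psqrt, dif_pos h, Matrix.PosSemidef.sqrt]
  have := Matrix.PosSemidef.mul_mul_conjTranspose_same (A := diagonal ((fun x : ℝ => (x : ℂ)) ∘ Real.sqrt ∘ h.1.eigenvalues))
    (Matrix.PosSemidef.diagonal (fun i => by simp [Real.sqrt_nonneg])) h.1.eigenvectorUnitary.1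
  exact this

lemma psqrt_mul_self {n : ℕ} {M : Matrix (Fin n) (Fin n) ℂ} (h : M.PosSemidef) :
    psqrt M * psqrt M = M := by
  rw [psqrt, dif_pos h, Matrix.PosSemidef.sqrt]
  have hs := h.1.spectral_theorem
  have hu : (star h.1.eigenvectorUnitary : Matrix (Fin n) (Fin n) ℂ) * h.1.eigenvectorUnitary.1 = 1 := by
    exact (Matrix.mem_unitaryGroup_iff'.1 h.1.eigenvectorUnitary.2)
  set U := h.1.eigenvectorUnitary.1 with hU
  set d := diagonal ((fun x : ℝ => (x : ℂ)) ∘ Real.sqrt ∘ h.1.eigenvalues) with hd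
  have hdd : d * d = diagonal ((RCLike.ofReal : ℝ → ℂ) ∘ h.1.eigenvalues) := by
    rw [hd, diagonal_mul_diagonal]
    congr 1
    funext i
    simp only [Function.comp]
    rw [← Complex.ofReal_mul, Real.mul_self_sqrt (h.eigenvalues_nonneg i)]
    rfl
  conv_rhs => rw [hs, Unitary.conjStarAlgAut_apply, ← hdd]
  calc U * d * _ * (U * d * _) = U * d * (star U * U) * d * star U := by
        simp only [Matrix.mul_assoc]; 
    _ = _ := by rw [hu, Matrix.mul_one]; simp only [Matrix.mul_assoc]; rfl

lemma psqrt_posDef {n : ℕ} {M : Matrix (Fin n) (Fin n) ℂ} (h : M.PosDef) :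
    (psqrt M).PosDef := by
  have h1 := psqrt_posSemidef h.posSemidef
  have h2 := psqrt_mul_self h.posSemidef
  have hu : IsUnit (psqrt M) := by
    have := h.isUnit
    rw [← h2, Matrix.isUnit_iff_isUnit_det, det_mul] at this
    rw [Matrix.isUnit_iff_isUnit_det]
    exact isUnit_of_mul_isUnit_left this
  exact h1.posDef_iff_isUnit.2 hu

lemma gm_spec {n : ℕ} {A B : Matrix (Fin n) (Fin n) ℂ} (hA : A.PosDef) (hB : B.PosDef) :
    (gm A B).PosDef ∧ gm A B * A⁻¹ * gm A B = B := by
  have hS := psqrt_posDef hA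
  have hSS := psqrt_mul_self hA.posSemidef
  set S := psqrt A with hSdef
  have hSi := hS.inv
  have hSd : IsUnit S.det := (Matrix.isUnit_iff_isUnit_det _).1 hS.isUnit
  have hI : (S⁻¹ * B * S⁻¹).PosDef := by
    have := (Matrix.IsUnit.posDef_star_left_conjugate_iff (x := B) hSi.isUnit).2 hB
    rwa [Matrix.star_eq_conjTranspose, hSi.1.eq] at this
  have hT := psqrt_posDef hI
  have hTT := psqrt_mul_self hI.posSemidef
  unfold gm
  rw [← hSdef]
  set T := psqrt (S⁻¹ * B * S⁻¹) with hTdef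
  constructor
  · have := (Matrix.IsUnit.posDef_star_left_conjugate_iff (x := T) hS.isUnit).2 hT
    rwa [Matrix.star_eq_conjTranspose, hS.1.eq] at this
  · have e : S * A⁻¹ * S = 1 := by
      rw [← hSS, Matrix.mul_inv_rev]
      rw [← Matrix.mul_assoc, Matrix.mul_nonsing_inv _ hSd, Matrix.one_mul, Matrix.nonsing_inv_mul _ hSd]
    calc S * T * S * A⁻¹ * (S * T * S) = S * T * (S * A⁻¹ * S) * T * S := by simp only [Matrix.mul_assoc]
      _ = S * (T * T) * S := by rw [e]; simp only [Matrix.mul_assoc, Matrix.one_mul]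
      _ = (S * S⁻¹) * B * (S⁻¹ * S) := by rw [hTT]; simp only [Matrix.mul_assoc]
      _ = B := by rw [Matrix.mul_nonsing_inv _ hSd, Matrix.nonsing_inv_mul _ hSd, Matrix.one_mul, Matrix.mul_one]

lemma mconj_norm_le {n : ℕ} (M : Matrix (Fin n) (Fin n) ℂ) : ‖mconj M‖ ≤ ‖M‖ := by
  rw [Matrix.cstar_norm_def]
  refine ContinuousLinearMap.opNorm_le_bound _ (norm_nonneg _) (fun x => ?_)
  have h := Matrix.l2_opNorm_mulVec M (WithLp.toLp 2 (star (WithLp.ofLp x)))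
  have hx : ‖(WithLp.toLp 2 (star (WithLp.ofLp x)) : EuclideanSpace ℂ (Fin n))‖ = ‖x‖ := by
    simp [EuclideanSpace.norm_eq]
  rw [hx] at h
  refine le_trans (le_of_eq ?_) h
  simp only [EuclideanSpace.norm_eq]
  congr 1
  refine Finset.sum_congr rfl fun i _ => ?_
  congr 1
  rw [Matrix.ofLp_toEuclideanCLM]
  simp only [mconj]
  rw [← norm_star]
  congr 1
  simp [Matrix.mulVec, dotProduct]

lemma mconj_mconj {n : ℕ} (M : Matrix (Fin n) (Fin n) ℂ) : mconj (mconj M) = M := by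
  ext; simp [mconj]

lemma mconj_norm {n : ℕ} (M : Matrix (Fin n) (Fin n) ℂ) : ‖mconj M‖ = ‖M‖ :=
  le_antisymm (mconj_norm_le M) (by simpa [mconj_mconj] using mconj_norm_le (mconj M))

lemma mconj_mul {n : ℕ} (M N : Matrix (Fin n) (Fin n) ℂ) : mconj (M * N) = mconj M * mconj N := by
  simp [mconj, Matrix.transpose_mul]

lemma mconj_add {n : ℕ} (M N : Matrix (Fin n) (Fin n) ℂ) : mconj (M + N) = mconj M + mconj N := by
  simp [mconj]

lemma mconj_smul {n : ℕ} (t : ℝ) (N : Matrix (Fin n) (Fin n) ℂ) : mconj (t • N) = t • mconj N := by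
  ext; simp [mconj]

lemma mconj_one {n : ℕ} : mconj (1 : Matrix (Fin n) (Fin n) ℂ) = 1 := by
  simp [mconj]

lemma mconj_conjTranspose {n : ℕ} (N : Matrix (Fin n) (Fin n) ℂ) : mconj Nᴴ = (mconj N)ᴴ := by
  ext; simp [mconj]

lemma mconj_posDef {n : ℕ} {N : Matrix (Fin n) (Fin n) ℂ} (h : N.PosDef) : (mconj N).PosDef :=
  h.conjTranspose.transpose

/-- basic properties of `P = W*W` and `G = ρ₂(W)²`. -/
lemma rho2_spec {n : ℕ} {W : Matrix (Fin n) (Fin n) ℂ} (hW : IsUnit W) :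
    (Wᴴ * W).PosDef ∧ (rho2 W).PosDef ∧
    rho2 W * rho2 W = gm (Wᴴ * W) (mconj (Wᴴ * W)) ∧
    (rho2 W * rho2 W) * (Wᴴ * W)⁻¹ * (rho2 W * rho2 W) = mconj (Wᴴ * W) := by
  have hP : (Wᴴ * W).PosDef := by
    have := (Matrix.IsUnit.posDef_star_left_conjugate_iff (x := 1) hW).2 Matrix.PosDef.one
    rwa [Matrix.mul_one] at this
  have hg := gm_spec hP (mconj_posDef hP)
  have h2 : rho2 W * rho2 W = gm (Wᴴ * W) (mconj (Wᴴ * W)) := psqrt_mul_self hg.1.posSemidef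
  exact ⟨hP, psqrt_posDef hg.1, h2, by rw [h2]; exact hg.2⟩

lemma norm_rho2_inv_le {n : ℕ} {Z : Matrix (Fin n) (Fin n) ℂ} (hZ : IsUnit Z) :
    ‖(rho2 Z)⁻¹‖ ≤ ‖Z⁻¹‖ := by
  obtain ⟨hP, hR, -, h⟩ := rho2_spec hZ
  set R := rho2 Z with hRdef
  have hRd : IsUnit R.det := (Matrix.isUnit_iff_isUnit_det _).1 hR.isUnit
  have hZd : IsUnit Z.det := (Matrix.isUnit_iff_isUnit_det _).1 hZ
  have hRi : (R⁻¹)ᴴ = R⁻¹ := hR.inv.1.eq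
  have e1 : R * R⁻¹ = 1 := Matrix.mul_nonsing_inv _ hRd
  have e2 : R⁻¹ * R = 1 := Matrix.nonsing_inv_mul _ hRd
  set G := R * R with hG
  set K := R⁻¹ * R⁻¹ with hK
  have hKG : K * G = 1 := by
    calc K * G = R⁻¹ * (R⁻¹ * R) * R := by simp only [hK, hG, Matrix.mul_assoc]
      _ = 1 := by rw [e2, Matrix.mul_one, e2]
  have hGK : G * K = 1 := mul_eq_one_comm.1 hKG
  have hKh : Kᴴ = K := by rw [hK, conjTranspose_mul, hRi]
  have hKP : (mconj Z * K)ᴴ * (mconj Z * K) = (Z⁻¹ᴴ)ᴴ * (Z⁻¹ᴴ) := by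
    calc (mconj Z * K)ᴴ * (mconj Z * K) = K * mconj (Zᴴ * Z) * K := by
          rw [conjTranspose_mul, hKh, mconj_mul, mconj_conjTranspose]; simp only [Matrix.mul_assoc]
      _ = (K * G) * (Zᴴ * Z)⁻¹ * (G * K) := by rw [← h]; simp only [Matrix.mul_assoc]
      _ = _ := by
        rw [hKG, hGK, Matrix.one_mul, Matrix.mul_one, Matrix.mul_inv_rev, conjTranspose_conjTranspose,
          conjTranspose_nonsing_inv]
  have n1 : ‖mconj Z * K‖ = ‖Z⁻¹‖ := by
    have := congrArg norm hKP
    rw [l2_opNorm_conjTranspose_mul_self, l2_opNorm_conjTranspose_mul_self, l2_opNorm_conjTranspose] at this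
    exact (mul_self_inj (norm_nonneg _) (norm_nonneg _)).1 this
  have n2 : ‖K‖ ≤ ‖Z⁻¹‖ * ‖Z⁻¹‖ := by
    have : K = mconj Z⁻¹ * (mconj Z * K) := by
      rw [← Matrix.mul_assoc, ← mconj_mul, Matrix.nonsing_inv_mul _ hZd, mconj_one, Matrix.one_mul]
    calc ‖K‖ = ‖mconj Z⁻¹ * (mconj Z * K)‖ := by rw [← this]
      _ ≤ _ := norm_mul_le _ _
      _ = _ := by rw [n1, mconj_norm]
  have n3 : ‖K‖ = ‖R⁻¹‖ * ‖R⁻¹‖ := by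
    rw [← l2_opNorm_conjTranspose_mul_self, hRi]
  rw [n3] at n2
  exact (mul_self_le_mul_self_iff (norm_nonneg _) (norm_nonneg _)).2 n2

/-- exponential decay for positive definite matrices -/
lemma norm_exp_neg_le {n : ℕ} {H : Matrix (Fin n) (Fin n) ℂ} (hH : H.PosDef)
    {t : ℝ} (ht : 0 ≤ t) : ‖NormedSpace.exp ((-t) • H)‖ ≤ Real.exp (-(‖H⁻¹‖⁻¹) * t) := by
  have hs := hH.1.spectral_theorem
  rw [Unitary.conjStarAlgAut_apply] at hs
  set lam := hH.1.eigenvalues with hl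
  have hpos : ∀ i, 0 < lam i := hH.eigenvalues_pos
  set V := hH.1.eigenvectorUnitary with hV
  set U : Matrix (Fin n) (Fin n) ℂ := V.1 with hU
  have hu : star U * U = 1 := Matrix.mem_unitaryGroup_iff'.1 V.2
  have hu' : U * star U = 1 := Matrix.mem_unitaryGroup_iff.1 V.2
  have hUi : U⁻¹ = star U := Matrix.inv_eq_right_inv hu'
  have hUu : IsUnit U := ⟨⟨U, star U, hu', hu⟩, rfl⟩
  have hnorm : ∀ M : Matrix (Fin n) (Fin n) ℂ, ‖U * M * U⁻¹‖ = ‖M‖ := by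
    intro M
    rw [hUi]
    have h1 : star U ∈ unitary (Matrix (Fin n) (Fin n) ℂ) := ⟨by simpa using hu', by simpa using hu⟩
    rw [CStarRing.norm_mul_mem_unitary _ h1, CStarRing.norm_mem_unitary_mul _ V.2]
  have hinv : H⁻¹ = U * diagonal (fun i => ((lam i)⁻¹ : ℂ)) * U⁻¹ := by
    apply Matrix.inv_eq_right_inv
    rw [hUi]
    conv_lhs => rw [hs]
    calc U * _ * star U * (U * _ * star U) = U * (diagonal ((RCLike.ofReal : ℝ → ℂ) ∘ lam) * (star U * U) *
          diagonal (fun i => ((lam i)⁻¹ : ℂ))) * star U := by simp only [Matrix.mul_assoc]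
      _ = 1 := by
        rw [hu, Matrix.mul_one, diagonal_mul_diagonal]
        have : (fun i => ((RCLike.ofReal : ℝ → ℂ) ∘ lam) i * ((lam i)⁻¹ : ℂ)) = fun _ => 1 := by
          funext i
          have : (lam i : ℂ) ≠ 0 := by exact_mod_cast (hpos i).ne'
          exact mul_inv_cancel₀ this
        rw [this, diagonal_one, Matrix.mul_one, hu']
  have hle : ∀ i, ‖H⁻¹‖⁻¹ ≤ lam i := by
    intro i
    have : (lam i)⁻¹ ≤ ‖H⁻¹‖ := by
      rw [hinv, hnorm, l2_opNorm_diagonal]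
      refine le_trans (le_of_eq ?_) (norm_le_pi_norm _ i)
      simp [abs_of_pos (hpos i)]
    exact inv_le_of_inv_le₀ (hpos i) this
  have hexp : NormedSpace.exp ((-t) • H) = U * diagonal (fun i => (Real.exp (-t * lam i) : ℂ)) * U⁻¹ := by
    have : (-t) • H = U * diagonal (fun i => ((-t * lam i : ℝ) : ℂ)) * U⁻¹ := by
      conv_lhs => rw [hs]
      rw [hUi, ← Matrix.smul_mul, ← Matrix.mul_smul, ← diagonal_smul]
      congr 3
      funext i
      simp
    rw [this, Matrix.exp_conj _ _ hUu, Matrix.exp_diagonal]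
    congr 3
    funext i
    rw [Pi.coe_exp, ← Complex.exp_eq_exp_ℂ, Complex.ofReal_exp]
  rw [hexp, hnorm, l2_opNorm_diagonal]
  refine (pi_norm_le_iff_of_nonneg (Real.exp_nonneg _)).2 fun i => ?_
  rw [Complex.norm_real, Real.norm_eq_abs, abs_of_pos (Real.exp_pos _)]
  apply Real.exp_le_exp.2
  nlinarith [hle i]

/-- Lyapunov estimate -/
lemma lyap {n : ℕ} (K X F : Matrix (Fin n) (Fin n) ℂ) (hF : X * K + Kᴴ * X = F)
    (b : ℝ → ℝ) (hb : IntegrableOn (fun t => b t ^ 2) (Set.Ioi 0))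
    (hb0 : Filter.Tendsto b Filter.atTop (nhds 0))
    (hbK : ∀ t, 0 ≤ t → ‖NormedSpace.exp ((-t) • K)‖ ≤ b t) :
    IntegrableOn (fun t : ℝ => ‖NormedSpace.exp ((-t) • K)‖ ^ 2) (Set.Ioi 0) ∧
    ‖X‖ ≤ (∫ t in Set.Ioi (0 : ℝ), ‖NormedSpace.exp ((-t) • K)‖ ^ 2) * ‖F‖ := by
  set E : ℝ → Matrix (Fin n) (Fin n) ℂ := fun t => NormedSpace.exp ((-t) • K) with hE
  set E' : ℝ → Matrix (Fin n) (Fin n) ℂ := fun t => NormedSpace.exp ((-t) • Kᴴ) with hE'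
  have hEE : ∀ t, E' t = (E t)ᴴ := by
    intro t
    simp only [hE, hE']
    rw [← Matrix.exp_conjTranspose, Matrix.conjTranspose_smul]
    simp
  have hn' : ∀ t, ‖E' t‖ = ‖E t‖ := fun t => by rw [hEE, l2_opNorm_conjTranspose]
  have dE : ∀ t, HasDerivAt E (-(K * E t)) t := by
    intro t
    have := (hasDerivAt_exp_smul_const' (𝕂 := ℝ) (-K) t)
    simpa [hE, smul_neg, neg_smul] using this
  have dE' : ∀ t, HasDerivAt E' (-(E' t * Kᴴ)) t := by
    intro t
    have := (hasDerivAt_exp_smul_const (𝕂 := ℝ) (-Kᴴ) t)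
    simpa [hE', smul_neg, neg_smul] using this
  have cE : Continuous E := continuous_iff_continuousAt.2 fun t => (dE t).continuousAt
  have cE' : Continuous E' := continuous_iff_continuousAt.2 fun t => (dE' t).continuousAt
  have hint : IntegrableOn (fun t : ℝ => ‖E t‖ ^ 2) (Set.Ioi 0) := by
    refine Integrable.mono' hb (by fun_prop) ?_
    refine (ae_restrict_iff' measurableSet_Ioi).2 (Filter.Eventually.of_forall fun t ht => ?_)
    rw [Real.norm_eq_abs, abs_of_nonneg (by positivity)]
    exact pow_le_pow_left₀ (norm_nonneg _) (hbK t (le_of_lt ht)) 2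
  refine ⟨hint, ?_⟩
  have dφ : ∀ t, HasDerivAt (fun t => E' t * X * E t) (-(E' t * F * E t)) t := by
    intro t
    refine HasDerivAt.congr_deriv (((dE' t).mul_const X).mul (dE t)) ?_
    rw [← hF]
    noncomm_ring
  have hFint : IntegrableOn (fun t => -(E' t * F * E t)) (Set.Ioi 0) := by
    refine Integrable.mono' (hint.mul_const ‖F‖) (by fun_prop) ?_
    refine Filter.Eventually.of_forall fun t => ?_
    rw [norm_neg]
    calc ‖E' t * F * E t‖ ≤ ‖E' t‖ * ‖F‖ * ‖E t‖ := norm_mul₃_le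
      _ = _ := by rw [hn']; ring
  have hlim : Filter.Tendsto (fun t => E' t * X * E t) Filter.atTop (nhds 0) := by
    have h0 : Filter.Tendsto (fun t => b t * ‖X‖ * b t) Filter.atTop (nhds 0) := by
      simpa using (hb0.mul_const ‖X‖).mul hb0
    refine squeeze_zero_norm' ?_ h0
    filter_upwards [Filter.eventually_ge_atTop 0] with t ht
    have h1 := hbK t ht
    have h2 : 0 ≤ b t := le_trans (norm_nonneg _) h1
    calc ‖E' t * X * E t‖ ≤ ‖E' t‖ * ‖X‖ * ‖E t‖ := norm_mul₃_le
      _ = ‖E t‖ * ‖X‖ * ‖E t‖ := by rw [hn']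
      _ ≤ _ := by gcongr
  have key := integral_Ioi_of_hasDerivAt_of_tendsto (a := 0) (dφ 0).continuousAt.continuousWithinAt
    (fun t _ => dφ t) hFint hlim
  have e0 : E' 0 * X * E 0 = X := by simp [hE, hE']
  rw [e0, zero_sub] at key
  rw [← norm_neg, ← key, ← integral_mul_const]
  refine norm_integral_le_of_norm_le (hint.mul_const ‖F‖) (Filter.Eventually.of_forall fun t => ?_)
  rw [norm_neg]
  calc ‖E' t * F * E t‖ ≤ ‖E' t‖ * ‖F‖ * ‖E t‖ := norm_mul₃_le
    _ = _ := by rw [hn']; ring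

lemma exp_bound_facts (c a : ℝ) (ha : 0 < a) :
    IntegrableOn (fun t : ℝ => (c * Real.exp (-a * t)) ^ 2) (Set.Ioi 0) ∧
    Filter.Tendsto (fun t : ℝ => c * Real.exp (-a * t)) Filter.atTop (nhds 0) ∧
    ∫ t in Set.Ioi (0 : ℝ), (c * Real.exp (-a * t)) ^ 2 = c ^ 2 / (2 * a) := by
  have e : ∀ t : ℝ, (c * Real.exp (-a * t)) ^ 2 = c ^ 2 * Real.exp ((-(2 * a)) * t) := by
    intro t
    rw [mul_pow, ← Real.exp_nat_mul]
    congr 2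
    push_cast; ring
  simp only [e]
  refine ⟨(integrableOn_exp_mul_Ioi (by linarith) 0).const_mul _, ?_, ?_⟩
  · have : Filter.Tendsto (fun t : ℝ => -a * t) Filter.atTop Filter.atBot :=
      Filter.tendsto_id.const_mul_atTop_of_neg (by linarith)
    simpa using (Real.tendsto_exp_atBot.comp this).const_mul c
  · rw [integral_const_mul, integral_exp_mul_Ioi (by linarith)]
    simp
    ring

lemma norm_inv_pos {n : ℕ} (hn : 0 < n) {R : Matrix (Fin n) (Fin n) ℂ} (hR : IsUnit R) :
    0 < ‖R⁻¹‖ := by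
  have : Nonempty (Fin n) := ⟨⟨0, hn⟩⟩
  refine norm_pos_iff.2 fun h => ?_
  have := Matrix.mul_nonsing_inv R ((Matrix.isUnit_iff_isUnit_det _).1 hR)
  rw [h, Matrix.mul_zero] at this
  exact zero_ne_one this

/-- derivative of the square root -/
lemma sqrt_bound {n : ℕ} (hn : 0 < n) {R X F : Matrix (Fin n) (Fin n) ℂ} (hR : R.PosDef)
    (h : X * R + R * X = F) : ‖X‖ ≤ 1 / 2 * ‖R⁻¹‖ * ‖F‖ := by
  have hr := norm_inv_pos hn hR.isUnit
  obtain ⟨h1, h2, h3⟩ := exp_bound_facts 1 (‖R⁻¹‖⁻¹) (inv_pos.2 hr)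
  have hb : ∀ t : ℝ, 0 ≤ t → ‖NormedSpace.exp ((-t) • R)‖ ≤ 1 * Real.exp (-(‖R⁻¹‖⁻¹) * t) := by
    intro t ht
    rw [one_mul]; exact norm_exp_neg_le hR ht
  obtain ⟨i1, i2⟩ := lyap R X F (by rw [hR.1.eq]; exact h) _ h1 h2 hb
  refine i2.trans (mul_le_mul_of_nonneg_right ?_ (norm_nonneg _))
  calc _ ≤ ∫ t in Set.Ioi (0 : ℝ), (1 * Real.exp (-(‖R⁻¹‖⁻¹) * t)) ^ 2 := by
        refine setIntegral_mono_on i1 h1 measurableSet_Ioi fun t ht => ?_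
        exact pow_le_pow_left₀ (norm_nonneg _) (hb t (le_of_lt ht)) 2
    _ = _ := by rw [h3]; field_simp

/-- derivative of the geometric mean -/
lemma mean_bound {n : ℕ} (hn : 0 < n) {R P X F : Matrix (Fin n) (Fin n) ℂ} (hR : R.PosDef)
    (hP : P.PosDef)
    (h : X * (P⁻¹ * (R * R)) + (P⁻¹ * (R * R))ᴴ * X = F) :
    ‖X‖ ≤ (∫ t in Set.Ioi (0 : ℝ), ‖NormedSpace.exp ((-t) • (P⁻¹ * (R * R)))‖ ^ 2) * ‖F‖ := by
  have hRd : IsUnit R.det := (Matrix.isUnit_iff_isUnit_det _).1 hR.isUnit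
  have hH : (R * P⁻¹ * R).PosDef := by
    have := (Matrix.IsUnit.posDef_star_left_conjugate_iff (x := P⁻¹) hR.isUnit).2 hP.inv
    rwa [Matrix.star_eq_conjTranspose, hR.1.eq] at this
  set H := R * P⁻¹ * R with hHdef
  have hr := norm_inv_pos hn hH.isUnit
  obtain ⟨h1, h2, h3⟩ := exp_bound_facts (‖R⁻¹‖ * ‖R‖) (‖H⁻¹‖⁻¹) (inv_pos.2 hr)
  have hb : ∀ t : ℝ, 0 ≤ t → ‖NormedSpace.exp ((-t) • (P⁻¹ * (R * R)))‖ ≤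
      ‖R⁻¹‖ * ‖R‖ * Real.exp (-(‖H⁻¹‖⁻¹) * t) := by
    intro t ht
    have e : (-t) • (P⁻¹ * (R * R)) = R⁻¹ * ((-t) • H) * R := by
      rw [Matrix.mul_smul, Matrix.smul_mul, hHdef]
      congr 1
      simp only [← Matrix.mul_assoc]
      rw [Matrix.nonsing_inv_mul _ hRd, Matrix.one_mul]
    rw [e, Matrix.exp_conj' _ _ hR.isUnit]
    calc _ ≤ ‖R⁻¹‖ * ‖NormedSpace.exp ((-t) • H)‖ * ‖R‖ := norm_mul₃_le
      _ ≤ ‖R⁻¹‖ * Real.exp (-(‖H⁻¹‖⁻¹) * t) * ‖R‖ := by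
        gcongr; exact norm_exp_neg_le hH ht
      _ = _ := by ring
  exact (lyap _ X F h _ h1 h2 hb).2
/-- bound on the derivative of `ρ₂(Z) = (Z*Z # conj(Z*Z))^{1/2}`:
`‖D(A)‖ ≤ (1/2) ‖Z⁻¹‖ β(Z) (1 + ‖C_Z‖²) ‖Z*A + A*Z‖`. -/
theorem stmt7 {n : ℕ} (hn : 0 < n) (Z : Matrix (Fin n) (Fin n) ℂ) (hZ : IsUnit Z)
    (D : Matrix (Fin n) (Fin n) ℂ →L[ℝ] Matrix (Fin n) (Fin n) ℂ)
    (hD : HasFDerivAt (rho2 (n := n)) D Z) :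
    ∀ A : Matrix (Fin n) (Fin n) ℂ,
      ‖D A‖ ≤ 1 / 2 * ‖Z⁻¹‖ * beta Z * (1 + ‖CZ Z‖ ^ 2) * ‖Zᴴ * A + Aᴴ * Z‖ := by
  intro A
  obtain ⟨hP, hR, hRR, hG⟩ := rho2_spec hZ
  set P := Zᴴ * Z with hPdef
  set Q := Zᴴ * A + Aᴴ * Z with hQ
  set R := rho2 Z with hRdef
  -- the path
  set γ : ℝ → Matrix (Fin n) (Fin n) ℂ := fun t => Z + t • A with hγ
  have γ0 : γ 0 = Z := by simp [hγ]
  have dγ : HasDerivAt γ A 0 := by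
    exact HasDerivAt.congr_deriv (((hasDerivAt_id (0 : ℝ)).smul_const A).const_add Z) (one_smul _ _)
  have dr : HasDerivAt (fun t => rho2 (γ t)) (D A) 0 := by
    have hD' : HasFDerivAt (rho2 (n := n)) D (γ 0) := by rw [γ0]; exact hD
    exact hD'.comp_hasDerivAt (0 : ℝ) dγ
  have dG : HasDerivAt (fun t => rho2 (γ t) * rho2 (γ t)) (D A * R + R * D A) 0 := by
    refine HasDerivAt.congr_deriv (dr.mul dr) ?_
    simp only [γ0, hRdef]
  set X := D A * R + R * D A with hX
  have quad : ∀ M N L : Matrix (Fin n) (Fin n) ℂ,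
      HasDerivAt (fun t : ℝ => M + t • N + (t * t) • L) N 0 := by
    intro M N L
    have a := ((hasDerivAt_id (0 : ℝ)).smul_const N).const_add M
    have b := ((hasDerivAt_id (0 : ℝ)).mul (hasDerivAt_id (0 : ℝ))).smul_const L
    refine HasDerivAt.congr_deriv (a.add b) ?_
    simp
  have hp : ∀ t, (γ t)ᴴ * γ t = P + t • Q + (t * t) • (Aᴴ * A) := by
    intro t
    simp only [hγ, hPdef, hQ, Matrix.conjTranspose_add, Matrix.conjTranspose_smul, Matrix.add_mul,
      Matrix.mul_add, Matrix.smul_mul, Matrix.mul_smul, star_trivial, smul_add, smul_smul]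
    abel
  have dp : HasDerivAt (fun t => (γ t)ᴴ * γ t) Q 0 := by
    simp only [hp]; exact quad _ _ _
  have dc : HasDerivAt (fun t => mconj ((γ t)ᴴ * γ t)) (mconj Q) 0 := by
    simp only [hp, mconj_add, mconj_smul]; exact quad _ _ _
  have di : HasDerivAt (fun t => ((γ t)ᴴ * γ t)⁻¹) (-(P⁻¹ * Q * P⁻¹)) 0 := by
    have h1 := hasFDerivAt_ringInverse (𝕜 := ℝ) hP.isUnit.unit
    have e : (hP.isUnit.unit : Matrix (Fin n) (Fin n) ℂ) = (γ 0)ᴴ * γ 0 := by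
      rw [γ0]; rfl
    rw [e] at h1
    have h3 := h1.comp_hasDerivAt (0 : ℝ) dp
    simp only [Matrix.nonsing_inv_eq_ringInverse]
    simpa [← Ring.inverse_unit, Function.comp_def] using h3
  have dL := (dG.mul di).mul dG
  have hev : (fun t => rho2 (γ t) * rho2 (γ t) * ((γ t)ᴴ * γ t)⁻¹ * (rho2 (γ t) * rho2 (γ t)))
      =ᶠ[nhds 0] fun t => mconj ((γ t)ᴴ * γ t) := by
    have hu : ∀ᶠ t in nhds (0 : ℝ), IsUnit (γ t) := by
      have : {W : Matrix (Fin n) (Fin n) ℂ | IsUnit W} ∈ nhds (γ 0) := by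
        rw [γ0]; exact Units.isOpen.mem_nhds hZ
      exact dγ.continuousAt this
    filter_upwards [hu] with t ht
    exact (rho2_spec ht).2.2.2
  have huniq := dL.unique (dc.congr_of_eventuallyEq hev)
  simp only [Pi.mul_apply, γ0, ← hPdef, ← hRdef] at huniq
  have hCZ : CZ Z = P⁻¹ * (R * R) := by rw [CZ, ← hPdef, hRR]
  have hCs : (CZ Z)ᴴ = R * R * P⁻¹ := by
    rw [hCZ]; simp only [conjTranspose_mul, hR.1.eq, hP.inv.1.eq]
  have hlyap : X * CZ Z + (CZ Z)ᴴ * X = mconj Q + (CZ Z)ᴴ * Q * CZ Z := by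
    rw [← huniq, hCs, hCZ]
    noncomm_ring
  have b1 : ‖X‖ ≤ beta Z * ‖mconj Q + (CZ Z)ᴴ * Q * CZ Z‖ := by
    rw [beta]
    have := mean_bound hn hR hP (X := X) (F := mconj Q + (CZ Z)ᴴ * Q * CZ Z) (by rw [← hCZ]; exact hlyap)
    rwa [← hCZ] at this
  have hβ : 0 ≤ beta Z := by
    rw [beta]; exact integral_nonneg fun t => by positivity
  have b2 : ‖mconj Q + (CZ Z)ᴴ * Q * CZ Z‖ ≤ (1 + ‖CZ Z‖ ^ 2) * ‖Q‖ := by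
    calc _ ≤ ‖mconj Q‖ + ‖(CZ Z)ᴴ * Q * CZ Z‖ := norm_add_le _ _
      _ ≤ ‖Q‖ + ‖(CZ Z)ᴴ‖ * ‖Q‖ * ‖CZ Z‖ := by
        rw [mconj_norm]; gcongr; exact norm_mul₃_le
      _ = _ := by rw [l2_opNorm_conjTranspose]; ring
  have b3 := sqrt_bound hn hR (X := D A) (F := X) rfl
  have b4 := norm_rho2_inv_le hZ
  calc ‖D A‖ ≤ 1 / 2 * ‖R⁻¹‖ * ‖X‖ := b3
    _ ≤ 1 / 2 * ‖Z⁻¹‖ * (beta Z * ((1 + ‖CZ Z‖ ^ 2) * ‖Q‖)) := by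
      gcongr
      exact b1.trans (mul_le_mul_of_nonneg_left b2 hβ)
    _ = _ := by ring
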